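/- For every integer q ≥ 6, there exist a real number c > 1 and a finite simple graph G on n vertices with minimum degree at least (1 - 1/(c·(q+1)))·n such that G admits no fractional K_q-decomposition. -/

import Mathlib

open scoped Classical

/-- A fractional `K_q`-decomposition of `G`: an assignment of non-negative real weights to the
copies of `K_q` (i.e. the `q`-cliques) of `G` such that for every edge of `G`, the total weight
of the `q`-cliques containing that edge is exactly `1`. -/
def SimpleGraph.HasFractionalDecomposition {V : Type*} [Fintype V] (G : SimpleGraph V)
    (q : ℕ) : Prop :=
  ∃ w : Finset V → ℝ, (∀ s, 0 ≤ w s) ∧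
    ∀ ⦃u v : V⦄, G.Adj u v →
      ∑ s ∈ Finset.univ.filter (fun s : Finset V => G.IsNClique q s ∧ u ∈ s ∧ v ∈ s), w s = 1

/-- Fractional decompositions are transported by graph isomorphisms. -/
theorem SimpleGraph.HasFractionalDecomposition.of_iso {V W : Type*} [Fintype V] [Fintype W]
    {G : SimpleGraph V} {H : SimpleGraph W} {q : ℕ} (e : G ≃g H)
    (h : H.HasFractionalDecomposition q) : G.HasFractionalDecomposition q := by
  obtain ⟨w, hw, hsum⟩ := h
  refine ⟨fun s => w (s.map e.toEquiv.toEmbedding), fun s => hw _, fun u v huv => ?_⟩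
  rw [← hsum (e.map_adj_iff.2 huv)]
  refine Finset.sum_equiv e.toEquiv.finsetCongr (fun s => ?_) (fun s _ => rfl)
  have hmem : ∀ x, e x ∈ s.map e.toEquiv.toEmbedding ↔ x ∈ s := fun x =>
    Finset.mem_map' e.toEquiv.toEmbedding
  have hcl : H.IsNClique q (s.map e.toEquiv.toEmbedding) ↔ G.IsNClique q s := by
    rw [SimpleGraph.isNClique_iff, SimpleGraph.isNClique_iff, Finset.card_map]
    refine and_congr_left fun _ => ?_
    rw [SimpleGraph.isClique_iff, SimpleGraph.isClique_iff, Finset.coe_map]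
    constructor
    · intro h a ha b hb hab
      exact e.map_adj_iff.1 (h (Set.mem_image_of_mem _ ha) (Set.mem_image_of_mem _ hb)
        fun hh => hab (e.toEquiv.injective hh))
    · rintro h _ ⟨a, ha, rfl⟩ _ ⟨b, hb, rfl⟩ hab
      exact e.map_adj_iff.2 (h ha hb fun hh => hab (by rw [hh]))
  simp only [Finset.mem_filter, Finset.mem_univ, true_and, Equiv.finsetCongr_apply]
  rw [hcl, hmem, hmem]

/-- Weak linear programming duality: a fractional `K_q`-decomposition forces every edge weighting
that is non-negative on all `q`-cliques to have non-negative total weight. -/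
theorem SimpleGraph.HasFractionalDecomposition.sum_nonneg {V : Type*} [Fintype V]
    {G : SimpleGraph V} {q : ℕ} (h : G.HasFractionalDecomposition q) (f : V → V → ℝ)
    (hf : ∀ s, G.IsNClique q s → 0 ≤ ∑ u ∈ s, ∑ v ∈ s, if u ≠ v then f u v else 0) :
    0 ≤ ∑ u, ∑ v, if G.Adj u v then f u v else 0 := by
  obtain ⟨w, hw, hsum⟩ := h
  have key : ∀ u v, (if G.Adj u v then f u v else 0) =
      ∑ s with G.IsNClique q s, w s *
        (if u ∈ s then if v ∈ s then if u ≠ v then f u v else 0 else 0 else 0) := by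
    intro u v
    by_cases huv : G.Adj u v
    · have h1 := congrArg (f u v * ·) (hsum huv)
      simp only [mul_one, Finset.mul_sum, Finset.sum_filter] at h1
      refine (if_pos huv).trans (h1.symm.trans ?_)
      rw [Finset.sum_filter]
      refine Finset.sum_congr rfl fun s _ => ?_
      by_cases h1 : G.IsNClique q s <;> by_cases h2 : u ∈ s <;> by_cases h3 : v ∈ s <;>
        simp [h1, h2, h3, huv.ne, mul_comm]
    · rw [if_neg huv]
      refine (Finset.sum_eq_zero fun s hs => ?_).symm
      split_ifs with h1 h2 h3
      · exact absurd ((Finset.mem_filter.1 hs).2.isClique h1 h2 h3) huv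
      all_goals simp
  simp_rw [key]
  rw [Finset.sum_congr rfl fun u _ => Finset.sum_comm, Finset.sum_comm]
  refine Finset.sum_nonneg fun s hs => ?_
  simp_rw [← Finset.mul_sum]
  refine mul_nonneg (hw s) ?_
  refine (hf s (Finset.mem_filter.1 hs).2).trans_eq ?_
  rw [← Finset.sum_subset (Finset.subset_univ s) fun u _ hu => by simp [hu]]
  refine Finset.sum_congr rfl fun u hu => ?_
  rw [← Finset.sum_subset (Finset.subset_univ s) fun v _ hv => by simp [hv]]
  exact Finset.sum_congr rfl fun v hv => by rw [if_pos hu, if_pos hv]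

/-- A regular graph with a distinguished set of vertices `S`, the other vertices being split into
two classes: if the total weight `q (1_S u + 1_S v) - 2 (q - 2) + q (q - 1) [u, v in one class]`
is negative, then there is no fractional `K_q`-decomposition. -/
theorem SimpleGraph.not_hasFractionalDecomposition_of_regular {V : Type*} [Fintype V]
    (G : SimpleGraph V) (q D : ℕ) (hD : ∀ u, ∑ v, (if G.Adj u v then (1 : ℝ) else 0) = D)
    (l : V → Option Bool)
    (hneg : 2 * q * D * (∑ u, if l u = none then (1 : ℝ) else 0)
      - 2 * (q - 2) * D * Fintype.card V
      + q * (q - 1) * (∑ u, ∑ v,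
        if G.Adj u v then if l u ≠ none ∧ l u = l v then (1 : ℝ) else 0 else 0) < 0) :
    ¬ G.HasFractionalDecomposition q := by
  intro h
  let a : V → ℝ := fun u => if l u = none then 1 else 0
  let b : V → V → ℝ := fun u v => if l u ≠ none ∧ l u = l v then 1 else 0
  have hpos := h.sum_nonneg
    (fun u v => q * (a u + a v) - 2 * (q - 2) + q * (q - 1) * b u v) ?_
  · have hsum : ∀ u v, (if G.Adj u v then
        q * (a u + a v) - 2 * (q - 2) + q * (q - 1) * b u v else 0) =
        q * (a u * if G.Adj u v then (1 : ℝ) else 0)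
        + q * (a v * if G.Adj v u then (1 : ℝ) else 0)
        - 2 * (q - 2) * (if G.Adj u v then (1 : ℝ) else 0)
        + q * (q - 1) * (if G.Adj u v then b u v else 0) := by
      intro u v
      rw [G.adj_comm v u]
      split_ifs <;> ring
    have hcomm : ∑ u, ∑ v, (q : ℝ) * (a v * if G.Adj v u then (1 : ℝ) else 0)
        = ∑ u, ∑ v, (q : ℝ) * (a u * if G.Adj u v then (1 : ℝ) else 0) := Finset.sum_comm
    simp only [hsum, Finset.sum_add_distrib, Finset.sum_sub_distrib, hcomm] at hpos
    simp only [← Finset.mul_sum, hD, ← Finset.sum_mul, Finset.sum_const, Finset.card_univ,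
      nsmul_eq_mul] at hpos
    simp only [a, b] at hpos
    linarith
  · intro s hs
    let n : Option Bool → ℝ := fun o => ∑ u ∈ s, if l u = o then 1 else 0
    have hcount : ∀ o, ∃ m : ℕ, n o = m := fun o => ⟨_, Finset.sum_boole _ _⟩
    have hcard : ∑ u ∈ s, (1 : ℝ) = q := by simp [hs.card_eq]
    have htot : n none + n (some true) + n (some false) = q := by
      rw [← hcard]
      simp only [n, ← Finset.sum_add_distrib]
      refine Finset.sum_congr rfl fun u _ => ?_
      rcases l u with _ | _ | _ <;> simp
    have hb : ∑ u ∈ s, ∑ v ∈ s, b u v = n (some true) ^ 2 + n (some false) ^ 2 := by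
      simp only [n, sq, Finset.sum_mul_sum, ← Finset.sum_add_distrib]
      refine Finset.sum_congr rfl fun u _ => Finset.sum_congr rfl fun v _ => ?_
      simp only [b]
      rcases l u with _ | _ | _ <;> rcases l v with _ | _ | _ <;> simp
    have ha : ∑ u ∈ s, a u = n none := rfl
    have hbd : ∑ u ∈ s, b u u = n (some true) + n (some false) := by
      simp only [n, ← Finset.sum_add_distrib]
      refine Finset.sum_congr rfl fun u _ => ?_
      simp only [b]
      rcases l u with _ | _ | _ <;> simp
    have hoff : ∀ F : V → V → ℝ, (∑ u ∈ s, ∑ v ∈ s, if u ≠ v then F u v else 0)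
        = ∑ u ∈ s, ∑ v ∈ s, F u v - ∑ u ∈ s, F u u := by
      intro F
      rw [← Finset.sum_sub_distrib]
      refine Finset.sum_congr rfl fun u hu => ?_
      rw [eq_sub_iff_add_eq, ← Finset.sum_ite_eq s u (F u) |>.trans (if_pos hu),
        ← Finset.sum_add_distrib]
      refine Finset.sum_congr rfl fun v _ => ?_
      by_cases huv : u = v <;> simp [huv]
    rw [hoff]
    simp only [Finset.sum_add_distrib, Finset.sum_sub_distrib, ← Finset.mul_sum, hb, hbd, ha,
      Finset.sum_const, hs.card_eq, nsmul_eq_mul]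
    obtain ⟨x, hx⟩ := hcount (some true)
    obtain ⟨y, hy⟩ := hcount (some false)
    have hint : ∀ m : ℕ, (0 : ℝ) ≤ ((m : ℝ) - 1) * (m - 2) := by
      intro m
      rcases m with _ | _ | m
      · norm_num
      · norm_num
      · push_cast
        have : (0 : ℝ) ≤ m := m.cast_nonneg
        nlinarith
    have hq : (0 : ℝ) ≤ q * (q - 1) := by
      rcases q with _ | q
      · simp
      · push_cast
        have : (0 : ℝ) ≤ q := q.cast_nonneg
        nlinarith
    have h3 := mul_nonneg hq (add_nonneg (hint x) (hint y))
    have hn : n none = q - x - y := by rw [← htot, hx, hy]; ring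
    rw [hx, hy, hn]
    linarith

/-- The join of a complete multipartite graph with `k` parts of size `11` and two copies of the
circulant graph on `ZMod 17` with connection set `{±1, ±2, ±3}`. -/
def multipartiteJoinCirculants (k : ℕ) :
    SimpleGraph ((Fin k × Fin 11) ⊕ (Bool × ZMod 17)) where
  Adj
    | .inl x, .inl y => x.1 ≠ y.1
    | .inr x, .inr y => x.1 ≠ y.1 ∨ x.2 - y.2 ∈ ({1, 2, 3, -1, -2, -3} : Finset (ZMod 17))
    | _, _ => True
  symm := ⟨by
    rintro (x | x) (y | y) h
    · exact Ne.symm h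
    · trivial
    · trivial
    · refine h.imp Ne.symm fun h => ?_
      rw [← neg_sub]
      generalize x.2 - y.2 = z at h
      revert z
      decide⟩
  loopless := ⟨by
    rintro (x | x) h
    · exact h rfl
    · rcases h with h | h
      · exact h rfl
      · rw [sub_self] at h
        revert h
        decide⟩

section

variable {k : ℕ} (x y : Fin k × Fin 11) (z w : Bool × ZMod 17)

theorem multipartiteJoinCirculants_adj_inl_inl :
    (multipartiteJoinCirculants k).Adj (.inl x) (.inl y) ↔ x.1 ≠ y.1 := Iff.rfl

theorem multipartiteJoinCirculants_adj_inl_inr :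
    (multipartiteJoinCirculants k).Adj (.inl x) (.inr z) ↔ True := Iff.rfl

theorem multipartiteJoinCirculants_adj_inr_inl :
    (multipartiteJoinCirculants k).Adj (.inr z) (.inl x) ↔ True := Iff.rfl

theorem multipartiteJoinCirculants_adj_inr_inr :
    (multipartiteJoinCirculants k).Adj (.inr z) (.inr w) ↔
      z.1 ≠ w.1 ∨ z.2 - w.2 ∈ ({1, 2, 3, -1, -2, -3} : Finset (ZMod 17)) := Iff.rfl

end

theorem circulant_sum (x : ZMod 17) : ∑ y : ZMod 17,
    (if x - y ∈ ({1, 2, 3, -1, -2, -3} : Finset (ZMod 17)) then (1 : ℝ) else 0) = 6 := by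
  rw [← Equiv.sum_comp (Equiv.subLeft x)]
  simp only [Equiv.subLeft_apply, sub_sub_cancel]
  rw [Finset.sum_boole, Finset.filter_mem_eq_inter, Finset.univ_inter]
  norm_cast

theorem multipartiteJoinCirculants_sum_adj (k : ℕ) (u) :
    ∑ v, (if (multipartiteJoinCirculants k).Adj u v then (1 : ℝ) else 0) = 11 * k + 23 := by
  rcases u with x | ⟨x, z⟩
  · have h : ∀ y : Fin k × Fin 11, (if x.1 ≠ y.1 then (1 : ℝ) else 0) =
        1 - if x.1 = y.1 then 1 else 0 := fun y => by by_cases h : x.1 = y.1 <;> simp [h]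
    simp only [Fintype.sum_sum_type, multipartiteJoinCirculants_adj_inl_inl, h,
      multipartiteJoinCirculants_adj_inl_inr, Fintype.sum_prod_type, Finset.sum_sub_distrib]
    have h11 : ∑ p : Fin k, ∑ _i : Fin 11, (if x.1 = p then (1 : ℝ) else 0) = 11 := by
      simp only [Finset.sum_const, nsmul_eq_mul, ← Finset.mul_sum, Finset.sum_ite_eq]
      simp
    rw [h11]
    simp [ZMod.card]
    ring
  · simp only [Fintype.sum_sum_type, multipartiteJoinCirculants_adj_inr_inl,
      multipartiteJoinCirculants_adj_inr_inr, Fintype.sum_prod_type, Fintype.sum_bool]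
    cases x <;> simp only [ne_eq, reduceCtorEq, not_true, not_false_eq_true, true_or, false_or,
      circulant_sum] <;> simp [ZMod.card] <;> ring

theorem multipartiteJoinCirculants_minDegree (k : ℕ) :
    (multipartiteJoinCirculants k).minDegree = 11 * k + 23 := by
  have hreg : (multipartiteJoinCirculants k).IsRegularOfDegree (11 * k + 23) := by
    intro u
    have h := multipartiteJoinCirculants_sum_adj k u
    rw [Finset.sum_boole] at h
    rw [← SimpleGraph.card_neighborFinset_eq_degree, SimpleGraph.neighborFinset_eq_filter]
    exact_mod_cast h
  exact hreg.minDegree_eq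

/-- For every integer `q ≥ 6`, there exist a real `c > 1` and a finite simple graph `G` on `n`
vertices with minimum degree at least `(1 - 1/(c·(q+1)))·n` admitting no fractional
`K_q`-decomposition. -/
theorem statement9 (q : ℕ) (hq : 6 ≤ q) :
    ∃ (c : ℝ) (n : ℕ) (G : SimpleGraph (Fin n)), 1 < c ∧
      (1 - 1 / (c * (q + 1))) * n ≤ (G.minDegree : ℝ) ∧
      ¬ G.HasFractionalDecomposition q := by
  obtain ⟨k, rfl⟩ : ∃ k, q = k + 2 := ⟨q - 2, by omega⟩
  have hk : (4 : ℝ) ≤ k := by exact_mod_cast (by omega : 4 ≤ k)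
  let H := multipartiteJoinCirculants k
  have hcard : Fintype.card ((Fin k × Fin 11) ⊕ (Bool × ZMod 17)) = 11 * k + 34 := by
    simp [ZMod.card]; ring
  let e := H.overFinIso hcard
  refine ⟨(11 * k + 34) / (11 * k + 33), 11 * k + 34, H.overFin hcard, ?_, ?_, fun h => ?_⟩
  · rw [lt_div_iff₀ (by positivity)]
    linarith
  · have hdeg : (H.overFin hcard).minDegree = 11 * k + 23 := by
      rw [← e.minDegree_eq]
      exact multipartiteJoinCirculants_minDegree k
    rw [hdeg]
    push_cast
    have : (11 * k + 34 : ℝ) / (11 * k + 33) * (k + 2 + 1) = (11 * k + 34) / 11 := by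
      field_simp
      ring
    rw [this]
    field_simp
    linarith
  · refine H.not_hasFractionalDecomposition_of_regular (k + 2) (11 * k + 23)
      (fun u => by rw [multipartiteJoinCirculants_sum_adj]; push_cast; ring)
      (Sum.elim (fun _ => none) fun x => some x.1) ?_ (h.of_iso e)
    have h1 : (∑ u : (Fin k × Fin 11) ⊕ (Bool × ZMod 17), if Sum.elim (fun _ => none)
        (fun x => some x.1) u = none then (1 : ℝ) else 0) = 11 * k := by
      simp [-Finset.sum_boole, Fintype.sum_sum_type]; ring
    have h2 : (∑ u : (Fin k × Fin 11) ⊕ (Bool × ZMod 17), ∑ v, if H.Adj u v then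
        if Sum.elim (fun _ => none) (fun x => some x.1) u ≠ none ∧
          Sum.elim (fun _ => none) (fun x => some x.1) u =
            Sum.elim (fun _ => none) (fun x => some x.1) v
        then (1 : ℝ) else 0 else 0) = 204 := by
      simp only [Fintype.sum_sum_type, Fintype.sum_prod_type, Fintype.sum_bool, H,
        multipartiteJoinCirculants_adj_inl_inl, multipartiteJoinCirculants_adj_inl_inr,
        multipartiteJoinCirculants_adj_inr_inl, multipartiteJoinCirculants_adj_inr_inr,
        Sum.elim_inl, Sum.elim_inr, ne_eq, reduceCtorEq, not_true, not_false_eq_true, true_or,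
        false_or, Option.some.injEq, and_self, and_false, false_and, if_true, if_false, ite_self,
        circulant_sum]
      simp [ZMod.card]
      norm_num
    rw [h1, h2, hcard]
    push_cast
    nlinarith
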